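/- arXiv:2302.02313 — 8 statements merged into one kernel-verified Lean document; each statement's English description precedes it below -/
import Mathlib

section
/- For any strategy profile C and any player v_i, one has u_i(1, C_{−i}) > u_i(0, C_{−i}) if and only if m_i(1, C_{−i}) = 1 (equivalently, no vertex of N_i ∪ {v_i} other than v_i has value 2, i.e. m_i of the profile with v_i's value set to 1 equals 1). -/
open Finset

section Defs

variable {V : Type*} [Fintype V] [DecidableEq V] (G : SimpleGraph V) [DecidableRel G.Adj]

/-- The closed neighborhood `N̄ᵢ = Nᵢ ∪ {vᵢ}` of a vertex. -/
def closedNbhd (i : V) : Finset V := insert i (G.neighborFinset i)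

/-- The graph has no isolated vertices. -/
def noIsolated : Prop := ∀ v : V, ∃ u : V, G.Adj v u

/-- `m_j(C) = 1` if no vertex of `N̄_j` has value 2 under `C`, and `0` otherwise. -/
def mval (C : V → Fin 3) (j : V) : ℕ :=
  if ∀ k ∈ closedNbhd G j, C k ≠ 2 then 1 else 0

/-- The utility `u_i(C) = -λ1·c_i² - λ2·Σ_{j ∈ N̄ᵢ} (2 - c_j)·m_j(C)`. -/
def util (lam1 lam2 : ℝ) (C : V → Fin 3) (i : V) : ℝ :=
  -lam1 * ((C i : ℕ) : ℝ) ^ 2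
    - lam2 * ∑ j ∈ closedNbhd G i, (2 - ((C j : ℕ) : ℝ)) * (mval G C j : ℝ)

/-- The potential function `π(C) = -λ1·Σ_j c_j² - λ2·Σ_j (2 - c_j)·m_j(C)`. -/
def pot (lam1 lam2 : ℝ) (C : V → Fin 3) : ℝ :=
  -lam1 * ∑ j : V, ((C j : ℕ) : ℝ) ^ 2
    - lam2 * ∑ j : V, (2 - ((C j : ℕ) : ℝ)) * (mval G C j : ℝ)

/-- `C` is a Nash equilibrium: no unilateral deviation strictly improves a player's utility. -/
def isNE (lam1 lam2 : ℝ) (C : V → Fin 3) : Prop :=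
  ∀ (i : V) (c : Fin 3),
    util G lam1 lam2 (Function.update C i c) i ≤ util G lam1 lam2 C i

/-- `C` is a Roman dominating function. -/
def isRDF (C : V → Fin 3) : Prop :=
  ∀ v : V, C v = 0 → ∃ u : V, G.Adj v u ∧ C u = 2

/-- The weight `γ_R(G,C) = Σ_v C(v)`. -/
def weight (C : V → Fin 3) : ℕ := ∑ v : V, (C v : ℕ)

/-- Decrease a value in `{0,1,2}` by one (truncated at 0). -/
def decr (c : Fin 3) : Fin 3 := ⟨c.val - 1, lt_of_le_of_lt (Nat.sub_le _ _) c.isLt⟩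

/-- `C` is a minimal RDF. -/
def isMRDF (C : V → Fin 3) : Prop :=
  isRDF G C ∧ ∀ i : V, 1 ≤ (C i : ℕ) → ¬ isRDF G (Function.update C i (decr (C i)))

/-- `C` is a strongly minimal RDF. -/
def isSRDF (C : V → Fin 3) : Prop :=
  isMRDF G C ∧
    ¬ ∃ (C' : V → Fin 3) (i : V), isRDF G C' ∧ weight C' < weight C ∧
      C' i = 2 ∧ (∀ j : V, G.Adj i j → C j = 1 → C' j = 0) ∧
      (∀ k : V, k ≠ i → ¬(G.Adj i k ∧ C k = 1) → C' k = C k)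

/-- `C` is a global minimum RDF. -/
def isGRDF (C : V → Fin 3) : Prop :=
  isRDF G C ∧ ∀ C' : V → Fin 3, isRDF G C' → weight C ≤ weight C'

/-- `Ñ_j(C)`: white neighbors of `v_j` for which `v_j` is the unique vertex of their closed
neighborhood with value 2. -/
def tildeN (C : V → Fin 3) (j : V) : Finset V :=
  (G.neighborFinset j).filter
    (fun k => C k = 0 ∧ C j = 2 ∧ ∀ l ∈ closedNbhd G k, C l = 2 → l = j)

/-- `m_{i,j}(C) = 1` iff `Ñ_j(C) ⊆ N_i`. -/
def mij (C : V → Fin 3) (i j : V) : ℕ :=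
  if tildeN G C j ⊆ G.neighborFinset i then 1 else 0

/-- `w_i(C) = Σ_{v_j ∈ N_i, c_j = 1} m_j(C) + 2·Σ_{v_j ∈ N_i, c_j = 2} m_{i,j}(C)`. -/
def wval (C : V → Fin 3) (i : V) : ℕ :=
  ∑ j ∈ (G.neighborFinset i).filter (fun j => C j = 1), mval G C j
    + 2 * ∑ j ∈ (G.neighborFinset i).filter (fun j => C j = 2), mij G C i j

/-- The coalition `τ_i` of the private contract proposed by `v_i`. -/
def coalition (C : V → Fin 3) (i : V) : Finset V :=
  insert i ((G.neighborFinset i).filter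
    (fun j => C j = 1 ∨ (C j = 2 ∧ mij G C i j = 1)))

/-- The contract profile: `v_i` takes value 2, the other coalition members take value 0. -/
def contract (C : V → Fin 3) (i : V) : V → Fin 3 :=
  fun k => if k = i then 2 else if k ∈ coalition G C i then 0 else C k

end Defs

/-- Whether a vertex is undominated does not depend on whether a given player plays `0` or `1`. -/
lemma mval_update_zero_eq_one {V : Type*} [Fintype V] [DecidableEq V] (G : SimpleGraph V)
    [DecidableRel G.Adj] (C : V → Fin 3) (i j : V) :
    mval G (Function.update C i 0) j = mval G (Function.update C i 1) j := by
  have h : ∀ k, Function.update C i 0 k ≠ 2 ↔ Function.update C i 1 k ≠ 2 := by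
    intro k
    by_cases hk : k = i
    · subst hk
      simp
    · simp [hk]
  simp only [mval, h]

/-- The gain of a player who moves from `0` to `1`. -/
lemma util_update_one_sub_zero {V : Type*} [Fintype V] [DecidableEq V] (G : SimpleGraph V)
    [DecidableRel G.Adj] (lam1 lam2 : ℝ) (C : V → Fin 3) (i : V) :
    util G lam1 lam2 (Function.update C i 1) i - util G lam1 lam2 (Function.update C i 0) i
      = lam2 * (mval G (Function.update C i 1) i : ℝ) - lam1 := by
  have hi : i ∉ G.neighborFinset i := by simp
  have hsum : ∑ j ∈ G.neighborFinset i,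
        (2 - ((Function.update C i 0 j : ℕ) : ℝ)) * (mval G (Function.update C i 1) j : ℝ)
      = ∑ j ∈ G.neighborFinset i,
        (2 - ((Function.update C i 1 j : ℕ) : ℝ)) * (mval G (Function.update C i 1) j : ℝ) := by
    refine Finset.sum_congr rfl fun j hj => ?_
    have hji : j ≠ i := fun h => hi (h ▸ hj)
    simp [hji]
  simp only [util, mval_update_zero_eq_one, closedNbhd, Finset.sum_insert hi, hsum,
    Function.update_self, Fin.val_zero, Fin.val_one, Nat.cast_zero, Nat.cast_one]
  ring

/-- For any strategy profile C and any player v_i, one has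
u_i(1, C_{−i}) > u_i(0, C_{−i}) if and only if m_i(1, C_{−i}) = 1. -/
theorem stmt1 {V : Type*} [Fintype V] [DecidableEq V] (G : SimpleGraph V)
    [DecidableRel G.Adj] (lam1 lam2 : ℝ)
    (h1 : 0 < 2 / 3 * lam2) (h2 : 2 / 3 * lam2 < lam1) (h3 : lam1 < 3 / 4 * lam2)
    (hiso : noIsolated G)
    (C : V → Fin 3) (i : V) :
    util G lam1 lam2 (Function.update C i 0) i < util G lam1 lam2 (Function.update C i 1) i
      ↔ mval G (Function.update C i 1) i = 1 := by
  have h := util_update_one_sub_zero G lam1 lam2 C i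
  rw [← sub_pos, h]
  by_cases hm : ∀ k ∈ closedNbhd G i, Function.update C i 1 k ≠ 2
  · have hv : mval G (Function.update C i 1) i = 1 := if_pos hm
    simp only [hv, Nat.cast_one, iff_true]
    linarith
  · have hv : mval G (Function.update C i 1) i = 0 := if_neg hm
    simp only [hv, Nat.cast_zero, zero_ne_one, iff_false]
    linarith
end

section
/- Every Nash equilibrium of the Roman domination game is a Roman dominating function: if C is a profile such that u_i(C) ≥ u_i(c, C_{−i}) for every vertex v_i and every c ∈ {0,1,2}, then every vertex v with C(v) = 0 has a neighbor u with C(u) = 2. -/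
open Finset

/-- Only the set of vertices of value 2 matters for `mval`. -/
theorem mval_update_of_ne_two {V : Type*} [Fintype V] [DecidableEq V] (G : SimpleGraph V)
    [DecidableRel G.Adj] (C : V → Fin 3) (i : V) {c : Fin 3} (hi : C i ≠ 2) (hc : c ≠ 2) (j : V) :
    mval G (Function.update C i c) j = mval G C j := by
  have h : ∀ k, Function.update C i c k ≠ 2 ↔ C k ≠ 2 := by
    intro k
    by_cases hk : k = i
    · subst hk
      simp [hi, hc]
    · simp [hk]
  simp only [mval, h]

/-- An undefended white vertex gains `lam2 - lam1` by switching to value 1. -/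
theorem util_update_one {V : Type*} [Fintype V] [DecidableEq V] (G : SimpleGraph V)
    [DecidableRel G.Adj] (lam1 lam2 : ℝ) (C : V → Fin 3) (v : V) (hv : C v = 0)
    (hu : ∀ u, G.Adj v u → C u ≠ 2) :
    util G lam1 lam2 (Function.update C v 1) v = util G lam1 lam2 C v + (lam2 - lam1) := by
  have hm : mval G C v = 1 := by
    simpa [mval, closedNbhd, hv] using hu
  have hsum : ∑ j ∈ G.neighborFinset v,
      (2 - ((Function.update C v 1 j : ℕ) : ℝ)) * (mval G C j : ℝ) =
      ∑ j ∈ G.neighborFinset v, (2 - ((C j : ℕ) : ℝ)) * (mval G C j : ℝ) := by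
    refine Finset.sum_congr rfl fun j hj => ?_
    rw [Function.update_of_ne ((G.mem_neighborFinset v j).1 hj).ne']
  have hmem : v ∉ G.neighborFinset v := by simp
  simp only [util, mval_update_of_ne_two G C v (c := 1) (by simp [hv]) (by decide)]
  rw [closedNbhd, Finset.sum_insert hmem, Finset.sum_insert hmem, hsum, hm, hv]
  simp only [Function.update_self, Fin.val_zero, Fin.val_one]
  push_cast
  ring

/-- Every Nash equilibrium of the Roman domination game is a Roman dominating
function. -/
theorem stmt2 {V : Type*} [Fintype V] [DecidableEq V] (G : SimpleGraph V)
    [DecidableRel G.Adj] (lam1 lam2 : ℝ)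
    (h1 : 0 < 2 / 3 * lam2) (h2 : 2 / 3 * lam2 < lam1) (h3 : lam1 < 3 / 4 * lam2)
    (hiso : noIsolated G)
    (C : V → Fin 3) (hNE : isNE G lam1 lam2 C) :
    isRDF G C := by
  intro v hv
  by_contra! hu
  have h := hNE v 1
  rw [util_update_one G lam1 lam2 C v hv hu] at h
  linarith
end

section
/- Every Nash equilibrium of the Roman domination game is a minimal Roman dominating function: if C is an NE, then C is an RDF and for every vertex v_i with c_i ≥ 1, the profile (c_i − 1, C_{−i}) is not an RDF. -/
open Finset

theorem mval_congr {V : Type*} [Fintype V] [DecidableEq V] (G : SimpleGraph V)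
    [DecidableRel G.Adj] {C C' : V → Fin 3} (h : ∀ k, C k = 2 ↔ C' k = 2) (j : V) :
    mval G C j = mval G C' j := by
  simp only [mval, ne_eq, h]

theorem mval_eq_zero {V : Type*} [Fintype V] [DecidableEq V] (G : SimpleGraph V)
    [DecidableRel G.Adj] {C : V → Fin 3} {j k : V} (hk : k ∈ closedNbhd G j) (h : C k = 2) :
    mval G C j = 0 :=
  if_neg fun H => H k hk h

theorem mval_le_one {V : Type*} [Fintype V] [DecidableEq V] (G : SimpleGraph V)
    [DecidableRel G.Adj] (C : V → Fin 3) (j : V) : mval G C j ≤ 1 := by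
  unfold mval
  split_ifs <;> simp

theorem sum_closedNbhd {V : Type*} [Fintype V] [DecidableEq V] (G : SimpleGraph V)
    [DecidableRel G.Adj] (i : V) (f : V → ℝ) :
    ∑ j ∈ closedNbhd G i, f j = f i + ∑ j ∈ G.neighborFinset i, f j :=
  Finset.sum_insert (by simp)

/-- Switching between the values 0 and 1 leaves every `mval` unchanged, so it only affects the
player's own terms. -/
theorem util_update_of_ne_two {V : Type*} [Fintype V] [DecidableEq V] (G : SimpleGraph V)
    [DecidableRel G.Adj] (lam1 lam2 : ℝ) {C : V → Fin 3} {i : V} {c : Fin 3}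
    (hi : C i ≠ 2) (hc : c ≠ 2) :
    util G lam1 lam2 (Function.update C i c) i = util G lam1 lam2 C i
      - lam1 * (((c : ℕ) : ℝ) ^ 2 - ((C i : ℕ) : ℝ) ^ 2)
      + lam2 * (((c : ℕ) : ℝ) - ((C i : ℕ) : ℝ)) * (mval G C i : ℝ) := by
  have hm (j : V) : mval G (Function.update C i c) j = mval G C j := by
    refine mval_congr G (fun k => ?_) j
    by_cases hk : k = i
    · subst hk
      simp [hi, hc]
    · simp [hk]
  have hs : ∑ j ∈ G.neighborFinset i,
        (2 - ((Function.update C i c j : ℕ) : ℝ)) * (mval G C j : ℝ)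
      = ∑ j ∈ G.neighborFinset i, (2 - ((C j : ℕ) : ℝ)) * (mval G C j : ℝ) := by
    refine Finset.sum_congr rfl fun j hj => ?_
    have hji : j ≠ i := by
      rintro rfl
      simp at hj
    rw [Function.update_of_ne hji]
  simp only [util, hm, sum_closedNbhd, hs, Function.update_self]
  ring

theorem isNE.mval_eq_zero_of_eq_zero {V : Type*} [Fintype V] [DecidableEq V]
    {G : SimpleGraph V} [DecidableRel G.Adj] {lam1 lam2 : ℝ} (h : lam1 < lam2)
    {C : V → Fin 3} (hNE : isNE G lam1 lam2 C) {i : V} (hi : C i = 0) : mval G C i = 0 := by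
  by_contra hm
  have hm1 : mval G C i = 1 := by
    have := mval_le_one G C i
    omega
  have hu := hNE i 1
  rw [util_update_of_ne_two G lam1 lam2 (by simp [hi]) (by decide)] at hu
  simp [hi, hm1] at hu
  linarith

theorem isNE.mval_ne_zero_of_eq_one {V : Type*} [Fintype V] [DecidableEq V]
    {G : SimpleGraph V} [DecidableRel G.Adj] {lam1 lam2 : ℝ} (h : 0 < lam1)
    {C : V → Fin 3} (hNE : isNE G lam1 lam2 C) {i : V} (hi : C i = 1) : mval G C i ≠ 0 := by
  intro hm
  have hu := hNE i 0
  rw [util_update_of_ne_two G lam1 lam2 (by simp [hi]) (by decide)] at hu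
  simp [hi, hm] at hu
  linarith

theorem isNE.isRDF_of_lt {V : Type*} [Fintype V] [DecidableEq V]
    {G : SimpleGraph V} [DecidableRel G.Adj] {lam1 lam2 : ℝ} (h : lam1 < lam2)
    {C : V → Fin 3} (hNE : isNE G lam1 lam2 C) : isRDF G C := by
  intro v hv
  have hm := hNE.mval_eq_zero_of_eq_zero h hv
  simp only [mval, ite_eq_right_iff, one_ne_zero, imp_false, not_forall, not_not] at hm
  obtain ⟨k, hk, hk2⟩ := hm
  rcases Finset.mem_insert.1 hk with rfl | hk
  · simp [hv] at hk2
  · exact ⟨k, by simpa using hk, hk2⟩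

theorem isNE.not_isRDF_update_zero {V : Type*} [Fintype V] [DecidableEq V]
    {G : SimpleGraph V} [DecidableRel G.Adj] {lam1 lam2 : ℝ} (h : 0 < lam1)
    {C : V → Fin 3} (hNE : isNE G lam1 lam2 C) {i : V} (hi : C i = 1) :
    ¬ isRDF G (Function.update C i 0) := by
  intro hR
  obtain ⟨u, hu, hu2⟩ := hR i (by simp)
  rw [Function.update_of_ne hu.ne'] at hu2
  exact hNE.mval_ne_zero_of_eq_one h hi
    (mval_eq_zero G (by simp [closedNbhd, hu]) hu2)

theorem isNE.not_isRDF_update_one {V : Type*} [Fintype V] [DecidableEq V]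
    {G : SimpleGraph V} [DecidableRel G.Adj] {lam1 lam2 : ℝ} (h : 0 < lam1)
    (h2 : 0 < lam2) (h12 : lam2 < 3 * lam1)
    {C : V → Fin 3} (hNE : isNE G lam1 lam2 C) {i : V} (hi : C i = 2) :
    ¬ isRDF G (Function.update C i 1) := by
  intro hR
  have hu := hNE i 1
  have hold : ∑ j ∈ closedNbhd G i, (2 - ((C j : ℕ) : ℝ)) * (mval G C j : ℝ) = 0 := by
    refine Finset.sum_eq_zero fun j hj => ?_
    rw [mval_eq_zero G (k := i) (by simpa [closedNbhd, G.adj_comm, eq_comm] using hj) hi]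
    simp
  have hnew : ∑ j ∈ G.neighborFinset i, (2 - ((Function.update C i 1 j : ℕ) : ℝ))
      * (mval G (Function.update C i 1) j : ℝ) = 0 := by
    refine Finset.sum_eq_zero fun j hj => ?_
    rw [SimpleGraph.mem_neighborFinset] at hj
    have hji : Function.update C i 1 j = C j := Function.update_of_ne hj.ne' _ _
    have hcases : C j = 0 ∨ C j = 1 ∨ C j = 2 := by
      generalize C j = c
      revert c
      decide
    rcases hcases with hj0 | hj1 | hj2
    · obtain ⟨u, hju, hu2⟩ := hR j (hji.trans hj0)
      rw [mval_eq_zero G (by simp [closedNbhd, hju]) hu2]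
      simp
    · exact absurd (mval_eq_zero G (by simp [closedNbhd, hj.symm]) hi)
        (hNE.mval_ne_zero_of_eq_one h hj1)
    · simp [hji, hj2]
  have hle : (mval G (Function.update C i 1) i : ℝ) ≤ 1 := by
    exact_mod_cast mval_le_one G _ i
  simp only [util, hold] at hu
  rw [sum_closedNbhd, hnew] at hu
  simp [hi] at hu
  nlinarith

/-- Every Nash equilibrium of the Roman domination game is a minimal Roman
dominating function. -/
theorem stmt3 {V : Type*} [Fintype V] [DecidableEq V] (G : SimpleGraph V)
    [DecidableRel G.Adj] (lam1 lam2 : ℝ)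
    (h1 : 0 < 2 / 3 * lam2) (h2 : 2 / 3 * lam2 < lam1) (h3 : lam1 < 3 / 4 * lam2)
    (hiso : noIsolated G)
    (C : V → Fin 3) (hNE : isNE G lam1 lam2 C) :
    isMRDF G C := by
  refine ⟨hNE.isRDF_of_lt (by linarith), fun i hi => ?_⟩
  have hcases : C i = 1 ∨ C i = 2 := by
    generalize C i = c at hi
    revert c
    decide
  rcases hcases with h | h
  · rw [h]
    exact hNE.not_isRDF_update_zero (by linarith) h
  · rw [h]
    exact hNE.not_isRDF_update_one (by linarith) (by linarith) (by linarith) h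
end

section
/- In any Nash equilibrium C of the Roman domination game, the following three conditions hold: (i) no vertex with value 1 is adjacent to a vertex with value 2; (ii) every vertex with value 0 is adjacent to at least one vertex with value 2; (iii) every vertex v_i with value 1 satisfies m_i(C) = 1. -/
open Finset

/-- A deviation that neither starts nor ends at value 2 leaves every `m_j` unchanged. -/
theorem mval_update {V : Type*} [Fintype V] [DecidableEq V] (G : SimpleGraph V)
    [DecidableRel G.Adj] (C : V → Fin 3) (i : V) (c : Fin 3) (hi : C i ≠ 2) (hc : c ≠ 2)
    (j : V) : mval G (Function.update C i c) j = mval G C j := by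
  have h (k : V) : Function.update C i c k ≠ 2 ↔ C k ≠ 2 := by
    rcases eq_or_ne k i with rfl | hk
    · simp [hi, hc]
    · simp [hk]
  simp only [mval, h]

/-- The player's own contribution to the utility, separated from that of the neighbors. -/
theorem util_eq_own_add_neighbors {V : Type*} [Fintype V] [DecidableEq V] (G : SimpleGraph V)
    [DecidableRel G.Adj] (lam1 lam2 : ℝ) (C : V → Fin 3) (i : V) :
    util G lam1 lam2 C i = -lam1 * ((C i : ℕ) : ℝ) ^ 2
      - lam2 * ((2 - ((C i : ℕ) : ℝ)) * (mval G C i : ℝ)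
        + ∑ j ∈ G.neighborFinset i, (2 - ((C j : ℕ) : ℝ)) * (mval G C j : ℝ)) := by
  rw [util, closedNbhd, Finset.sum_insert (by simp)]

/-- The change of utility under a deviation between values other than 2. -/
theorem util_update_sub {V : Type*} [Fintype V] [DecidableEq V] (G : SimpleGraph V)
    [DecidableRel G.Adj] (lam1 lam2 : ℝ) (C : V → Fin 3) (i : V) (c : Fin 3)
    (hi : C i ≠ 2) (hc : c ≠ 2) :
    util G lam1 lam2 (Function.update C i c) i - util G lam1 lam2 C i =
      lam1 * (((C i : ℕ) : ℝ) ^ 2 - ((c : ℕ) : ℝ) ^ 2)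
        + lam2 * (((c : ℕ) : ℝ) - ((C i : ℕ) : ℝ)) * (mval G C i : ℝ) := by
  have hsum : ∑ j ∈ G.neighborFinset i,
        (2 - ((Function.update C i c j : ℕ) : ℝ)) * (mval G C j : ℝ) =
      ∑ j ∈ G.neighborFinset i, (2 - ((C j : ℕ) : ℝ)) * (mval G C j : ℝ) := by
    refine Finset.sum_congr rfl fun j hj => ?_
    have hji : j ≠ i := ((G.mem_neighborFinset i j).1 hj).ne'
    rw [Function.update_of_ne hji]
  simp only [util_eq_own_add_neighbors, mval_update G C i c hi hc, hsum, Function.update_self]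
  ring

/-- In any Nash equilibrium C: (i) no vertex with value 1 is adjacent to a vertex
with value 2; (ii) every vertex with value 0 is adjacent to at least one vertex with value 2;
(iii) every vertex with value 1 satisfies m_i(C) = 1. -/
theorem stmt4 {V : Type*} [Fintype V] [DecidableEq V] (G : SimpleGraph V)
    [DecidableRel G.Adj] (lam1 lam2 : ℝ)
    (h1 : 0 < 2 / 3 * lam2) (h2 : 2 / 3 * lam2 < lam1) (h3 : lam1 < 3 / 4 * lam2)
    (hiso : noIsolated G)
    (C : V → Fin 3) (hNE : isNE G lam1 lam2 C) :
    (∀ i j : V, G.Adj i j → C i = 1 → C j ≠ 2) ∧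
    (∀ i : V, C i = 0 → ∃ j : V, G.Adj i j ∧ C j = 2) ∧
    (∀ i : V, C i = 1 → mval G C i = 1) := by
  have h_one : ∀ i : V, C i = 1 → mval G C i = 1 := by
    intro i hi
    by_contra hm
    have hm0 : mval G C i = 0 := by
      unfold mval at hm ⊢
      split_ifs at hm ⊢ <;> simp_all
    have hle := hNE i 0
    have hsub := util_update_sub G lam1 lam2 C i 0 (by simp [hi]) (by decide)
    simp [hi, hm0] at hsub
    linarith
  refine ⟨fun i j hij hi hj => ?_, fun i hi => ?_, h_one⟩
  · have hm := h_one i hi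
    have hmem : j ∈ closedNbhd G i := by simp [closedNbhd, hij]
    rw [mval, if_neg fun h => h j hmem hj] at hm
    exact zero_ne_one hm
  · by_contra! hno
    have hm : mval G C i = 1 := by
      refine if_pos fun k hk => ?_
      rcases Finset.mem_insert.1 hk with rfl | hk
      · simp [hi]
      · exact hno k ((G.mem_neighborFinset i k).1 hk)
    have hle := hNE i 1
    have hsub := util_update_sub G lam1 lam2 C i 1 (by simp [hi]) (by decide)
    simp [hi, hm] at hsub
    linarith
end

section
/- For any strongly minimal Roman dominating function C, neither of the following substructures occurs: (a) a vertex with value 1 having at least two neighbors with value 1; (b) a vertex with value 0 having at least three neighbors with value 1. -/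
open Finset

/-- Under a strongly minimal RDF, the value of a vertex and the values of its neighbors of
value 1 add up to at most 2. -/
theorem isSRDF.val_add_card_le_two {V : Type*} [Fintype V] [DecidableEq V] {G : SimpleGraph V}
    [DecidableRel G.Adj] {C : V → Fin 3} (hS : isSRDF G C) (i : V) :
    (C i : ℕ) + ((G.neighborFinset i).filter (fun j => C j = 1)).card ≤ 2 := by
  by_contra! hlt
  let C' : V → Fin 3 := fun k => if k = i then 2 else if G.Adj i k ∧ C k = 1 then 0 else C k
  refine hS.2 ⟨C', i, ?_, ?_, by simp [C'], ?_, ?_⟩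
  · intro v hv
    by_cases hvi : v = i
    · simp [C', hvi] at hv
    by_cases hadj : G.Adj i v ∧ C v = 1
    · exact ⟨i, hadj.1.symm, by simp [C']⟩
    · simp only [C', if_neg hvi, if_neg hadj] at hv
      obtain ⟨u, huv, hu⟩ := hS.1.1 v hv
      exact ⟨u, huv, by simp [C', hu]⟩
  · have key : ∀ k, (C' k : ℕ) + (if k = i then (C i : ℕ) else 0)
        + (if k ∈ (G.neighborFinset i).filter (fun j => C j = 1) then 1 else 0)
        = C k + if k = i then 2 else 0 := by
      intro k
      by_cases hki : k = i
      · subst hki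
        simp [C', add_comm]
      · by_cases hadj : G.Adj i k ∧ C k = 1 <;> simp [C', hki, hadj]
    have hsum := Finset.sum_congr (rfl : (univ : Finset V) = univ) fun k _ => key k
    simp only [sum_add_distrib, sum_ite_eq', mem_univ, if_true, sum_ite_mem, univ_inter,
      sum_const, smul_eq_mul, mul_one] at hsum
    unfold weight
    omega
  · intro j hj hj1
    simp [C', hj, hj1, hj.ne']
  · intro k hki hk
    simp [C', hki, hk]

/-- For any strongly minimal RDF C, there is no vertex with value 1 having at
least two neighbors with value 1, and no vertex with value 0 having at least three neighbors
with value 1. -/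
theorem stmt6 {V : Type*} [Fintype V] [DecidableEq V] (G : SimpleGraph V)
    [DecidableRel G.Adj] (hiso : noIsolated G)
    (C : V → Fin 3) (hS : isSRDF G C) :
    (¬ ∃ i : V, C i = 1 ∧ 2 ≤ ((G.neighborFinset i).filter (fun j => C j = 1)).card) ∧
    (¬ ∃ i : V, C i = 0 ∧ 3 ≤ ((G.neighborFinset i).filter (fun j => C j = 1)).card) := by
  constructor <;> rintro ⟨i, hi, hcard⟩ <;> have h := hS.val_add_card_le_two i <;>
    simp only [hi, Fin.val_one, Fin.val_zero] at h <;> omega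
end

section
/- Let C be a global minimum Roman dominating function of G. Then: (i) no vertex with value 1 is adjacent to a vertex with value 2; (ii) for every vertex v_i with value 2, there are at least two vertices v_j ∈ N̄_i such that v_i is the unique vertex of N̄_j with value 2. -/
open Finset

/-- Changing one value of a profile shifts the weight by the difference of the values. -/
theorem weight_update {V : Type*} [Fintype V] [DecidableEq V] (C : V → Fin 3) (i : V)
    (a : Fin 3) : weight (Function.update C i a) + (C i : ℕ) = weight C + (a : ℕ) := by
  unfold weight
  have h : ∑ v ∈ univ.erase i, (Function.update C i a v : ℕ)
      = ∑ v ∈ univ.erase i, (C v : ℕ) := by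
    refine Finset.sum_congr rfl fun v hv => ?_
    rw [Function.update_of_ne (Finset.ne_of_mem_erase hv)]
  rw [← Finset.add_sum_erase univ _ (mem_univ i), h,
    ← Finset.add_sum_erase univ (fun v => (C v : ℕ)) (mem_univ i), Function.update_self]
  omega

theorem mem_closedNbhd {V : Type*} [Fintype V] [DecidableEq V] (G : SimpleGraph V)
    [DecidableRel G.Adj] (i j : V) : j ∈ closedNbhd G i ↔ j = i ∨ G.Adj i j := by
  simp [closedNbhd]

/-- If C is a global minimum RDF, then (i) no vertex with value 1 is adjacent to a
vertex with value 2; (ii) for every vertex v_i with value 2 there are at least two vertices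
v_j ∈ N̄_i such that v_i is the unique vertex of N̄_j with value 2. -/
theorem stmt8 {V : Type*} [Fintype V] [DecidableEq V] (G : SimpleGraph V)
    [DecidableRel G.Adj] (hiso : noIsolated G)
    (C : V → Fin 3) (hG : isGRDF G C) :
    (∀ i j : V, G.Adj i j → C i = 1 → C j ≠ 2) ∧
    (∀ i : V, C i = 2 →
      2 ≤ ((closedNbhd G i).filter
        (fun j => ∀ k ∈ closedNbhd G j, C k = 2 → k = i)).card) := by
  obtain ⟨hR, hmin⟩ := hG
  refine ⟨fun i j hij hi hj => ?_, fun i hi => ?_⟩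
  · have hw := weight_update C i 0
    have hle := hmin (Function.update C i 0) fun v hv => by
      by_cases hvi : v = i
      · subst hvi
        exact ⟨j, hij, by rwa [Function.update_of_ne hij.ne']⟩
      · rw [Function.update_of_ne hvi] at hv
        obtain ⟨u, hu, hu2⟩ := hR v hv
        refine ⟨u, hu, ?_⟩
        rwa [Function.update_of_ne]
        rintro rfl
        simp [hi] at hu2
    simp [hi] at hw
    omega
  · by_contra hcard
    set S := (closedNbhd G i).filter (fun j => ∀ k ∈ closedNbhd G j, C k = 2 → k = i) with hS
    have other : ∀ v, (v = i ∨ G.Adj i v) → v ∉ S →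
        ∃ k, (k = v ∨ G.Adj v k) ∧ C k = 2 ∧ k ≠ i := by
      intro v hv hvS
      simp only [hS, mem_filter, mem_closedNbhd, not_and, not_forall] at hvS
      obtain ⟨k, hk, hk2, hne⟩ := hvS hv
      exact ⟨k, hk, hk2, hne⟩
    have zero_dominated : ∀ v, C v = 0 → v ∉ S → ∃ k, G.Adj v k ∧ C k = 2 ∧ k ≠ i := by
      intro v hv hvS
      obtain ⟨u, hu, hu2⟩ := hR v hv
      by_cases hui : u = i
      · obtain ⟨k, hk, hk2, hki⟩ := other v (.inr (hui ▸ hu.symm)) hvS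
        refine ⟨k, hk.resolve_left ?_, hk2, hki⟩
        rintro rfl
        simp [hv] at hk2
      · exact ⟨u, hu, hu2, hui⟩
    by_cases hsub : ∃ j ∈ S, j ≠ i
    · obtain ⟨j, hjS, hji⟩ := hsub
      have hSj : ∀ v ∈ S, v = j := fun v hv =>
        Finset.card_le_one.mp (by omega) v hv j hjS
      have hj2 : C j ≠ 2 := fun h =>
        hji ((mem_filter.mp hjS).2 j ((mem_closedNbhd G j j).mpr (.inl rfl)) h)
      have hw₁ := weight_update C i 0
      have hw₂ := weight_update (Function.update C i 0) j 1
      have hle := hmin (Function.update (Function.update C i 0) j 1) fun v hv => by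
        have hvj : v ≠ j := by
          rintro rfl
          simp at hv
        have hvS : v ∉ S := fun h => hvj (hSj v h)
        have hk : ∃ k, G.Adj v k ∧ C k = 2 ∧ k ≠ i := by
          by_cases hvi : v = i
          · obtain ⟨k, hk, hk2, hki⟩ := other v (.inl hvi) hvS
            exact ⟨k, hk.resolve_left fun h => hki (h.trans hvi), hk2, hki⟩
          · rw [Function.update_of_ne hvj, Function.update_of_ne hvi] at hv
            exact zero_dominated v hv hvS
        obtain ⟨k, hvk, hk2, hki⟩ := hk
        refine ⟨k, hvk, ?_⟩
        have hkj : k ≠ j := fun h => hj2 (h ▸ hk2)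
        rwa [Function.update_of_ne hkj, Function.update_of_ne hki]
      simp [hi] at hw₁ hw₂
      omega
    · have hw := weight_update C i 1
      have hle := hmin (Function.update C i 1) fun v hv => by
        have hvi : v ≠ i := by
          rintro rfl
          simp at hv
        rw [Function.update_of_ne hvi] at hv
        obtain ⟨k, hvk, hk2, hki⟩ := zero_dominated v hv fun h => hsub ⟨v, h, hvi⟩
        exact ⟨k, hvk, by rwa [Function.update_of_ne hki]⟩
      simp [hi] at hw
      omega
end

section
/- The Roman domination game is an exact potential game with potential function π: for any vertex v_i, any values c, c' ∈ {0,1,2}, and any profile C, one has π(c, C_{−i}) − π(c', C_{−i}) = u_i(c, C_{−i}) − u_i(c', C_{−i}). -/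
open Finset

/-- The closed neighborhood relation is symmetric. -/
lemma mem_closedNbhd_comm {V : Type*} [Fintype V] [DecidableEq V] (G : SimpleGraph V)
    [DecidableRel G.Adj] {i j : V} : i ∈ closedNbhd G j ↔ j ∈ closedNbhd G i := by
  simp [closedNbhd, G.adj_comm, eq_comm]

/-- Changing the value at `i` does not affect `m_j` outside the closed neighborhood of `i`. -/
lemma mval_update_of_notMem {V : Type*} [Fintype V] [DecidableEq V] (G : SimpleGraph V)
    [DecidableRel G.Adj] (C : V → Fin 3) {i j : V} (c : Fin 3) (hj : j ∉ closedNbhd G i) :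
    mval G (Function.update C i c) j = mval G C j := by
  have hne : ∀ k ∈ closedNbhd G j, k ≠ i := by
    rintro k hk rfl
    exact hj ((mem_closedNbhd_comm G).1 hk)
  have hiff : (∀ k ∈ closedNbhd G j, Function.update C i c k ≠ 2) ↔
      ∀ k ∈ closedNbhd G j, C k ≠ 2 :=
    forall₂_congr fun k hk => by rw [Function.update_of_ne (hne k hk)]
  simp only [mval, hiff]

/-- The part of the potential not seen by player `i` does not depend on the value at `i`. -/
lemma pot_sub_util_update {V : Type*} [Fintype V] [DecidableEq V] (G : SimpleGraph V)
    [DecidableRel G.Adj] (lam1 lam2 : ℝ) (C : V → Fin 3) (i : V) (c : Fin 3) :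
    pot G lam1 lam2 (Function.update C i c) - util G lam1 lam2 (Function.update C i c) i =
      -lam1 * ∑ j ∈ univ.erase i, ((C j : ℕ) : ℝ) ^ 2
        - lam2 * ∑ j ∈ (closedNbhd G i)ᶜ, (2 - ((C j : ℕ) : ℝ)) * (mval G C j : ℝ) := by
  have hsq : ∑ j ∈ univ.erase i, ((Function.update C i c j : ℕ) : ℝ) ^ 2 =
      ∑ j ∈ univ.erase i, ((C j : ℕ) : ℝ) ^ 2 :=
    sum_congr rfl fun j hj => by rw [Function.update_of_ne (ne_of_mem_erase hj)]
  have hm : ∑ j ∈ (closedNbhd G i)ᶜ, (2 - ((Function.update C i c j : ℕ) : ℝ)) *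
        (mval G (Function.update C i c) j : ℝ) =
      ∑ j ∈ (closedNbhd G i)ᶜ, (2 - ((C j : ℕ) : ℝ)) * (mval G C j : ℝ) := by
    refine sum_congr rfl fun j hj => ?_
    rw [mem_compl] at hj
    have hji : j ≠ i := by
      rintro rfl
      exact hj (mem_insert_self _ _)
    rw [mval_update_of_notMem G C c hj, Function.update_of_ne hji]
  rw [pot, util, ← add_sum_erase univ _ (mem_univ i), ← sum_add_sum_compl (closedNbhd G i),
    hsq, hm]
  ring

/-- The Roman domination game is an exact potential game with potential π. -/
theorem stmt10 {V : Type*} [Fintype V] [DecidableEq V] (G : SimpleGraph V)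
    [DecidableRel G.Adj] (lam1 lam2 : ℝ)
    (h1 : 0 < 2 / 3 * lam2) (h2 : 2 / 3 * lam2 < lam1) (h3 : lam1 < 3 / 4 * lam2)
    (hiso : noIsolated G)
    (C : V → Fin 3) (i : V) (c c' : Fin 3) :
    pot G lam1 lam2 (Function.update C i c) - pot G lam1 lam2 (Function.update C i c')
      = util G lam1 lam2 (Function.update C i c) i
        - util G lam1 lam2 (Function.update C i c') i := by
  linarith [pot_sub_util_update G lam1 lam2 C i c, pot_sub_util_update G lam1 lam2 C i c']
end

section
/- Let C be a strategy profile, v_i a vertex with c_i = 0, and v_j ∈ N_i a vertex with c_j = 2 such that m_{i,j}(C) = 1. Let C' be the profile obtained from C by setting C'(v_i) = 2 and C'(v_j) = 0 (all other values unchanged). Then C' has no new free white vertex: every vertex v with C'(v) = 0 and m_v(C') = 1 already satisfies C(v) = 0 and m_v(C) = 1. -/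
open Finset

/-- If c_i = 0, v_j ∈ N_i has c_j = 2 and m_{i,j}(C) = 1, then the profile C'
obtained by setting C'(v_i) = 2 and C'(v_j) = 0 has no new free white vertex. -/
theorem stmt15 {V : Type*} [Fintype V] [DecidableEq V] (G : SimpleGraph V)
    [DecidableRel G.Adj] (hiso : noIsolated G)
    (C : V → Fin 3) (i j : V) (hadj : G.Adj i j) (hi : C i = 0) (hj : C j = 2)
    (hmij : mij G C i j = 1) :
    ∀ v : V,
      Function.update (Function.update C i 2) j 0 v = 0 →
      mval G (Function.update (Function.update C i 2) j 0) v = 1 →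
      C v = 0 ∧ mval G C v = 1 := by
  have hij : i ≠ j := hadj.ne
  have hsub : tildeN G C j ⊆ G.neighborFinset i := by
    by_contra h
    simp [mij, h] at hmij
  intro v hv hm
  have hfree : ∀ k ∈ closedNbhd G v,
      Function.update (Function.update C i 2) j 0 k ≠ 2 := by
    by_contra h
    simp only [mval, if_neg h] at hm
    exact absurd hm (by decide)
  have hupd_i : Function.update (Function.update C i 2) j 0 i = 2 := by
    simp [Function.update_of_ne hij]
  have hi_notMem : i ∉ closedNbhd G v := fun h => hfree i h hupd_i
  have hvi : v ≠ i := fun h => hi_notMem (by simp [closedNbhd, h])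
  have hvj : v ≠ j := fun h => hi_notMem (by simp [closedNbhd, h, hadj.symm])
  have hCv : C v = 0 := by
    rwa [Function.update_of_ne hvj, Function.update_of_ne hvi] at hv
  have honly : ∀ l ∈ closedNbhd G v, C l = 2 → l = j := by
    intro l hl h2
    by_contra hlj
    have hli : l ≠ i := fun h => hi_notMem (h ▸ hl)
    apply hfree l hl
    rwa [Function.update_of_ne hlj, Function.update_of_ne hli]
  refine ⟨hCv, if_pos fun k hk h2 => ?_⟩
  have hkj : k = j := honly k hk h2
  have hvadj : G.Adj v j := by
    rw [hkj, closedNbhd, mem_insert, SimpleGraph.mem_neighborFinset] at hk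
    exact hk.resolve_left hvj.symm
  have hmem : v ∈ tildeN G C j :=
    mem_filter.2 ⟨(G.mem_neighborFinset j v).2 hvadj.symm, hCv, hj, honly⟩
  have hiv : G.Adj i v := (G.mem_neighborFinset i v).1 (hsub hmem)
  exact hi_notMem (by simp [closedNbhd, hiv.symm])
end
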